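/- arXiv:2209.12835 — 2 statements merged into one kernel-verified Lean document; each statement's English description precedes it below -/
import Mathlib

section
/- Let p : ℝ^d → ℝ be a continuously differentiable, strictly positive probability density with respect to Lebesgue measure, let s := ∇p/p (the score ∇ log p), and let P be the probability measure with density p. Let Q be a Borel probability measure on ℝ^d with ∫ ‖s(x)‖ dQ(x) < ∞. If for every i ∈ {1,…,d} and every smooth compactly supported function φ : ℝ^d → ℝ one has ∫ (∂_i φ(x) + s_i(x) φ(x)) dQ(x) = 0, then Q = P. -/
open MeasureTheory Filter Topology

open scoped ContDiff Convolution NNReal ENNReal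

/-- Two locally finite measures on `ℝ^d` agreeing on `C_c^∞` are equal. -/
lemma aux_measure_ext {d : ℕ} (μ ν : Measure (EuclideanSpace ℝ (Fin d)))
    [IsLocallyFiniteMeasure μ] [IsLocallyFiniteMeasure ν]
    (h : ∀ ψ : EuclideanSpace ℝ (Fin d) → ℝ, ContDiff ℝ ∞ ψ → HasCompactSupport ψ →
      ∫ x, ψ x ∂μ = ∫ x, ψ x ∂ν) : μ = ν := by
  apply Measure.ext_of_integral_eq_on_compactlySupported
  intro f
  have hfc : Continuous f := f.continuous
  have hfs : HasCompactSupport f := f.hasCompactSupport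
  obtain ⟨R, hR0, hR⟩ := hfs.isCompact.isBounded.subset_closedBall_lt 0 0
  let χ : ContDiffBump (0 : EuclideanSpace ℝ (Fin d)) := ⟨R, R + 1, hR0, by linarith⟩
  have hχ1 : ∀ x, f x ≠ 0 → χ x = 1 := fun x hx =>
    χ.one_of_mem_closedBall (hR (subset_tsupport _ hx))
  have hχc : Continuous χ := χ.continuous
  have key : ∀ ε : ℝ, 0 < ε → ∃ g : EuclideanSpace ℝ (Fin d) → ℝ, ContDiff ℝ ∞ g ∧
      HasCompactSupport g ∧ ∀ x, ‖f x - g x‖ ≤ ε * χ x := by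
    intro ε hε
    obtain ⟨g, hg, hgf⟩ :=
      (hfs.uniformContinuous_of_continuous hfc).exists_contDiff_dist_le hε
    refine ⟨fun x => χ x * g x, χ.contDiff.mul hg, χ.hasCompactSupport.mul_right, fun x => ?_⟩
    have h1 : f x - χ x * g x = χ x * (f x - g x) := by
      by_cases hx : f x = 0
      · rw [hx]; ring
      · rw [hχ1 x hx]; ring
    rw [h1, norm_mul, Real.norm_of_nonneg χ.nonneg, mul_comm]
    have := (hgf x).le
    rw [dist_comm, dist_eq_norm] at this
    exact mul_le_mul_of_nonneg_right this χ.nonneg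
  have bound : ∀ (ρ : Measure (EuclideanSpace ℝ (Fin d))) [IsLocallyFiniteMeasure ρ],
      ∀ g : EuclideanSpace ℝ (Fin d) → ℝ, ∀ ε : ℝ, ContDiff ℝ ∞ g → HasCompactSupport g →
      (∀ x, ‖f x - g x‖ ≤ ε * χ x) → |∫ x, f x ∂ρ - ∫ x, g x ∂ρ| ≤ ε * ∫ x, χ x ∂ρ := by
    intro ρ _ g ε hg hgs hb
    rw [← integral_sub (hfc.integrable_of_hasCompactSupport hfs)
      (hg.continuous.integrable_of_hasCompactSupport hgs), ← integral_const_mul]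
    exact norm_integral_le_of_norm_le
      ((hχc.integrable_of_hasCompactSupport χ.hasCompactSupport).const_mul _)
      (Eventually.of_forall hb)
  set C := ∫ x, χ x ∂μ + ∫ x, χ x ∂ν with hC
  have hC0 : 0 ≤ C := add_nonneg (integral_nonneg fun x => χ.nonneg)
    (integral_nonneg fun x => χ.nonneg)
  have hb : ∀ ε : ℝ, 0 < ε → |∫ x, f x ∂μ - ∫ x, f x ∂ν| ≤ ε * C := by
    intro ε hε
    obtain ⟨g, hg, hgs, hgb⟩ := key ε hε
    have h1 := bound μ g ε hg hgs hgb
    have h2 := bound ν g ε hg hgs hgb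
    rw [h g hg hgs] at h1
    rw [abs_le] at *
    constructor <;> rw [hC] <;> nlinarith [h1.1, h1.2, h2.1, h2.2]
  by_contra hne
  have hpos : 0 < |∫ x, f x ∂μ - ∫ x, f x ∂ν| := abs_pos.mpr (sub_ne_zero.mpr hne)
  have h3 := hb (|∫ x, f x ∂μ - ∫ x, f x ∂ν| / (2 * (C + 1))) (by positivity)
  rw [div_mul_eq_mul_div, le_div_iff₀ (by positivity)] at h3
  nlinarith

/-- A locally finite measure killing all `∂_i ψ`, `ψ ∈ C_c^1`, is translation invariant. -/
lemma aux_invariant {d : ℕ} (μ : Measure (EuclideanSpace ℝ (Fin d)))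
    [IsLocallyFiniteMeasure μ]
    (h : ∀ (i : Fin d) (ψ : EuclideanSpace ℝ (Fin d) → ℝ), ContDiff ℝ 1 ψ → HasCompactSupport ψ →
      ∫ x, fderiv ℝ ψ x (EuclideanSpace.single i 1) ∂μ = 0) : μ.IsAddLeftInvariant := by
  have hconst : ∀ ψ : EuclideanSpace ℝ (Fin d) → ℝ, ContDiff ℝ 1 ψ → HasCompactSupport ψ →
      ∀ v, ∫ x, ψ (v - x) ∂μ = ∫ x, ψ (0 - x) ∂μ := by
    intro ψ hψ hψs v
    have hc' : Continuous (fderiv ℝ ψ) := hψ.continuous_fderiv one_ne_zero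
    have hs' : HasCompactSupport (fderiv ℝ ψ) := hψs.fderiv ℝ
    have hci : ∀ x, Integrable (fun t => fderiv ℝ ψ (x - t)) μ := fun x =>
      (hc'.comp (continuous_const.sub continuous_id)).integrable_of_hasCompactSupport
        (hs'.comp_homeomorph (Homeomorph.subLeft x))
    obtain ⟨M, hM⟩ := hs'.exists_bound_of_continuous hc'
    have hM0 : 0 ≤ M := (norm_nonneg _).trans (hM 0)
    obtain ⟨R, hR⟩ := hs'.isCompact.isBounded.subset_closedBall 0
    have hd : ∀ x, HasFDerivAt (fun v => ∫ t, ψ (v - t) ∂μ) (∫ t, fderiv ℝ ψ (x - t) ∂μ) x := by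
      intro x
      refine hasFDerivAt_integral_of_dominated_of_fderiv_le
        (F := fun v t => ψ (v - t)) (F' := fun v t => fderiv ℝ ψ (v - t))
        (bound := (Metric.closedBall x (R + 1)).indicator fun _ => M)
        (Metric.ball_mem_nhds x one_pos) ?_ ?_ ?_ ?_ ?_ ?_
      · exact Eventually.of_forall fun v =>
          (hψ.continuous.comp (continuous_const.sub continuous_id)).aestronglyMeasurable
      · exact (hψ.continuous.comp
          (continuous_const.sub continuous_id)).integrable_of_hasCompactSupport
          (hψs.comp_homeomorph (Homeomorph.subLeft x))
      · exact (hci x).aestronglyMeasurable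
      · refine Eventually.of_forall fun t v hv => ?_
        by_cases ht : t ∈ Metric.closedBall x (R + 1)
        · rw [Set.indicator_of_mem ht]
          exact hM _
        · rw [Set.indicator_of_notMem ht]
          have h0 : fderiv ℝ ψ (v - t) = 0 := by
            by_contra hne
            apply ht
            have h1 := hR (subset_tsupport _ hne)
            rw [mem_closedBall_zero_iff, ← dist_eq_norm] at h1
            rw [Metric.mem_ball] at hv
            rw [Metric.mem_closedBall]
            have := dist_triangle t v x
            rw [dist_comm t v] at this
            linarith
          simp [h0]
      · exact (integrable_indicator_iff Metric.isClosed_closedBall.measurableSet).mpr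
          (integrableOn_const (isCompact_closedBall x (R + 1)).measure_lt_top.ne)
      · refine Eventually.of_forall fun t v hv => ?_
        exact ((hψ.differentiable one_ne_zero (v - t)).hasFDerivAt.comp v
          ((hasFDerivAt_id v).sub_const t))
    refine is_const_of_fderiv_eq_zero (𝕜 := ℝ) (f := fun v => ∫ t, ψ (v - t) ∂μ)
      (fun x => (hd x).differentiableAt) (fun x => ?_) _ _
    rw [(hd x).fderiv]
    apply ContinuousLinearMap.coe_injective
    refine (EuclideanSpace.basisFun (Fin d) ℝ).toBasis.ext fun i => ?_
    simp only [OrthonormalBasis.coe_toBasis, EuclideanSpace.basisFun_apply,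
      ContinuousLinearMap.coe_coe]
    rw [ContinuousLinearMap.integral_apply (hci x)]
    have h2 := h i (fun t => ψ (x - t)) (hψ.comp (by fun_prop))
      (hψs.comp_homeomorph (Homeomorph.subLeft x))
    have h3 : ∀ t, fderiv ℝ (fun t => ψ (x - t)) t (EuclideanSpace.single i 1)
        = - (fderiv ℝ ψ (x - t) (EuclideanSpace.single i 1)) := by
      intro t
      have := ((hψ.differentiable one_ne_zero (x - t)).hasFDerivAt.comp t
        ((hasFDerivAt_id t).const_sub x))
      have h4 := this.fderiv
      change fderiv ℝ (fun t => ψ (x - t)) t = _ at h4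
      rw [h4]; simp
    simp only [h3, integral_neg, neg_eq_zero] at h2
    simpa using h2
  refine ⟨fun v => ?_⟩
  have : IsFiniteMeasureOnCompacts (Measure.map (fun x => v + x) μ) :=
    Measure.IsFiniteMeasureOnCompacts.map μ (Homeomorph.addLeft v)
  apply aux_measure_ext
  intro ψ hψ hψs
  rw [(Homeomorph.addLeft v).measurableEmbedding.integral_map (μ := μ) (f := fun x => v + x) ψ]
  have h1 := hconst (fun x => ψ (-x)) ((hψ.of_le (by exact_mod_cast le_top)).comp contDiff_neg)
    (hψs.comp_homeomorph (Homeomorph.neg _)) (-v)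
  simpa [add_comm] using h1

/-- The Stein equation extends from `C_c^∞` to `C_c^1`. -/
lemma aux_extend {d : ℕ}
    (s : EuclideanSpace ℝ (Fin d) → EuclideanSpace ℝ (Fin d)) (hsc : Continuous s)
    (Q : Measure (EuclideanSpace ℝ (Fin d))) [IsProbabilityMeasure Q]
    (hQs : Integrable (fun x => ‖s x‖) Q) (i : Fin d)
    (hstein : ∀ (φ : EuclideanSpace ℝ (Fin d) → ℝ),
      ContDiff ℝ (⊤ : ℕ∞) φ → HasCompactSupport φ →
      ∫ x, (fderiv ℝ φ x (EuclideanSpace.single i 1) + s x i * φ x) ∂Q = 0)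
    (φ : EuclideanSpace ℝ (Fin d) → ℝ) (hφ : ContDiff ℝ 1 φ) (hφs : HasCompactSupport φ) :
    ∫ x, (fderiv ℝ φ x (EuclideanSpace.single i 1) + s x i * φ x) ∂Q = 0 := by
  set e : EuclideanSpace ℝ (Fin d) := EuclideanSpace.single i 1
  have hint : ∀ φ : EuclideanSpace ℝ (Fin d) → ℝ, ContDiff ℝ 1 φ → HasCompactSupport φ →
      Integrable (fun x => fderiv ℝ φ x e + s x i * φ x) Q := by
    intro φ hφ hφs
    have hc1 : Continuous (fun x => fderiv ℝ φ x e) :=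
      (hφ.continuous_fderiv one_ne_zero).clm_apply continuous_const
    have hc2 : Continuous (fun x => s x i * φ x) := by
      have := hφ.continuous
      fun_prop
    exact (hc1.integrable_of_hasCompactSupport (hφs.fderiv_apply ℝ e)).add
      (hc2.integrable_of_hasCompactSupport hφs.mul_left)
  have hc1 : Continuous (fun x => fderiv ℝ φ x e) :=
    (hφ.continuous_fderiv one_ne_zero).clm_apply continuous_const
  have hu1 := (hφs.fderiv_apply ℝ e).uniformContinuous_of_continuous hc1
  have hu2 := hφs.uniformContinuous_of_continuous hφ.continuous
  set C := ∫ x, (1 + ‖s x‖) ∂Q with hC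
  have hC0 : 0 ≤ C := integral_nonneg fun x => by positivity
  set I := ∫ x, (fderiv ℝ φ x e + s x i * φ x) ∂Q with hI
  have hb : ∀ ε : ℝ, 0 < ε → |I| ≤ ε * C := by
    intro ε hε
    obtain ⟨δ₁, hδ₁, h1⟩ := Metric.uniformContinuous_iff.mp hu1 ε hε
    obtain ⟨δ₂, hδ₂, h2⟩ := Metric.uniformContinuous_iff.mp hu2 ε hε
    have hδ : 0 < min δ₁ δ₂ := lt_min hδ₁ hδ₂
    let ρ : ContDiffBump (0 : EuclideanSpace ℝ (Fin d)) :=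
      ⟨min δ₁ δ₂ / 2, min δ₁ δ₂, by linarith, by linarith⟩
    let g := (ρ.normed volume ⋆[ContinuousLinearMap.lsmul ℝ ℝ, volume] φ)
    have hρli : LocallyIntegrable (ρ.normed volume) volume :=
      ρ.continuous_normed.locallyIntegrable
    have hg : ContDiff ℝ (⊤ : ℕ∞) g :=
      ρ.hasCompactSupport_normed.contDiff_convolution_left _ ρ.contDiff_normed
        hφ.continuous.locallyIntegrable
    have hgs : HasCompactSupport g := HasCompactSupport.convolution _ ρ.hasCompactSupport_normed hφs
    have hgd : ∀ x, fderiv ℝ g x e =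
        (ρ.normed volume ⋆[ContinuousLinearMap.lsmul ℝ ℝ, volume] (fun x => fderiv ℝ φ x e)) x := by
      intro x
      rw [(hφs.hasFDerivAt_convolution_right (ContinuousLinearMap.lsmul ℝ ℝ) hρli hφ x).fderiv,
        convolution_precompR_apply _ hρli (hφs.fderiv ℝ) (hφ.continuous_fderiv one_ne_zero)]
    have b1 : ∀ x, ‖fderiv ℝ φ x e - fderiv ℝ g x e‖ ≤ ε := by
      intro x
      rw [hgd, ← dist_eq_norm, dist_comm]
      exact ρ.dist_normed_convolution_le hc1.aestronglyMeasurable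
        fun y hy => (h1 (lt_of_lt_of_le hy (min_le_left _ _))).le
    have b2 : ∀ x, ‖φ x - g x‖ ≤ ε := by
      intro x
      rw [← dist_eq_norm, dist_comm]
      exact ρ.dist_normed_convolution_le hφ.continuous.aestronglyMeasurable
        fun y hy => (h2 (lt_of_lt_of_le hy (min_le_right _ _))).le
    have e1 : I = ∫ x, ((fderiv ℝ φ x e + s x i * φ x) - (fderiv ℝ g x e + s x i * g x)) ∂Q := by
      rw [integral_sub (hint φ hφ hφs) (hint g (hg.of_le (by exact_mod_cast le_top)) hgs),
        hstein g hg hgs, sub_zero]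
    rw [e1, hC, ← integral_const_mul, ← Real.norm_eq_abs]
    refine norm_integral_le_of_norm_le (((integrable_const (1 : ℝ)).add hQs).const_mul _)
      (Eventually.of_forall fun x => ?_)
    have e2 : (fderiv ℝ φ x e + s x i * φ x) - (fderiv ℝ g x e + s x i * g x)
        = (fderiv ℝ φ x e - fderiv ℝ g x e) + s x i * (φ x - g x) := by ring
    have e3 : ‖s x i‖ ≤ ‖s x‖ := PiLp.norm_apply_le (s x) i
    rw [e2]
    calc _ ≤ ‖fderiv ℝ φ x e - fderiv ℝ g x e‖ + ‖s x i‖ * ‖φ x - g x‖ := by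
            rw [← norm_mul]; exact norm_add_le _ _
      _ ≤ ε + ‖s x‖ * ε := by gcongr; exacts [b1 x, b2 x]
      _ = _ := by ring
  by_contra hne
  have hpos : 0 < |I| := abs_pos.mpr hne
  have h3 := hb (|I| / (2 * (C + 1))) (by positivity)
  rw [div_mul_eq_mul_div, le_div_iff₀ (by positivity)] at h3
  nlinarith

/-- **Score P-separation.** If `Q` finitely integrates the score `s = ∇ log p` of a
continuously differentiable strictly positive density `p` and satisfies the
distributional Stein equations `∫ (∂ᵢφ + sᵢ φ) dQ = 0` for all smooth compactly
supported test functions `φ`, then `Q = P`. -/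
theorem score_separation_of_stein_equations {d : ℕ}
    (p : EuclideanSpace ℝ (Fin d) → ℝ)
    (hp_diff : ContDiff ℝ 1 p)
    (hp_pos : ∀ x, 0 < p x)
    (hp_int : ∫ x, p x = 1)
    (s : EuclideanSpace ℝ (Fin d) → EuclideanSpace ℝ (Fin d))
    (hs : ∀ x, s x = (p x)⁻¹ • gradient p x)
    (P : Measure (EuclideanSpace ℝ (Fin d)))
    (hP : P = volume.withDensity (fun x => ENNReal.ofReal (p x)))
    (Q : Measure (EuclideanSpace ℝ (Fin d))) [IsProbabilityMeasure Q]
    (hQs : Integrable (fun x => ‖s x‖) Q)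
    (hstein : ∀ (i : Fin d) (φ : EuclideanSpace ℝ (Fin d) → ℝ),
      ContDiff ℝ (⊤ : ℕ∞) φ → HasCompactSupport φ →
      ∫ x, (fderiv ℝ φ x (EuclideanSpace.single i 1) + s x i * φ x) ∂Q = 0) :
    Q = P := by
  have hpd : Differentiable ℝ p := hp_diff.differentiable one_ne_zero
  have hpc : Continuous p := hp_diff.continuous
  have hgc : Continuous (gradient p) := by
    unfold gradient
    exact (InnerProductSpace.toDual ℝ _).symm.continuous.comp
      (hp_diff.continuous_fderiv one_ne_zero)
  have hsc : Continuous s := by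
    rw [funext hs]
    exact (hpc.inv₀ fun x => (hp_pos x).ne').smul hgc
  have hsi : ∀ x i, s x i = (p x)⁻¹ * fderiv ℝ p x (EuclideanSpace.single i 1) := by
    intro x i
    rw [hs, PiLp.smul_apply, smul_eq_mul]
    congr 1
    have h1 : inner ℝ (gradient p x) (EuclideanSpace.single i (1 : ℝ))
        = fderiv ℝ p x (EuclideanSpace.single i 1) := by
      unfold gradient
      exact InnerProductSpace.toDual_symm_apply
    rw [← h1, EuclideanSpace.inner_single_right]
    simp
  let q : EuclideanSpace ℝ (Fin d) → ℝ≥0 := fun x => Real.toNNReal (p x)⁻¹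
  have hqc : Continuous q :=
    continuous_real_toNNReal.comp (hpc.inv₀ fun x => (hp_pos x).ne')
  let μ : Measure (EuclideanSpace ℝ (Fin d)) := Q.withDensity (fun x => (q x : ℝ≥0∞))
  have : IsLocallyFiniteMeasure μ := IsLocallyFiniteMeasure.withDensity_coe hqc
  have hinv : μ.IsAddLeftInvariant := by
    apply aux_invariant
    intro i ψ hψ hψs
    rw [integral_withDensity_eq_integral_smul hqc.measurable]
    have hφ : ContDiff ℝ 1 (fun x => ψ x * (p x)⁻¹) := hψ.mul (hp_diff.inv fun x => (hp_pos x).ne')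
    rw [← aux_extend s hsc Q hQs i (hstein i) (fun x => ψ x * (p x)⁻¹) hφ hψs.mul_right]
    congr 1
    ext x
    have hp0 : p x ≠ 0 := (hp_pos x).ne'
    have hd := ((hψ.differentiable one_ne_zero x).hasFDerivAt.mul
      ((hasDerivAt_inv hp0).comp_hasFDerivAt x (hpd x).hasFDerivAt)).fderiv
    change fderiv ℝ (fun x => ψ x * (p x)⁻¹) x = _ at hd
    rw [hd, hsi, NNReal.smul_def, Real.coe_toNNReal _ (inv_nonneg.mpr (hp_pos x).le)]
    simp
    field_simp
    ring
  have hμ := Measure.isAddLeftInvariant_eq_smul μ volume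
  set c := Measure.addHaarScalarFactor μ volume
  have hPprob : P Set.univ = 1 := by
    have hpi : Integrable p := by
      by_contra hn
      rw [integral_undef hn] at hp_int
      exact zero_ne_one hp_int
    rw [hP, withDensity_apply _ MeasurableSet.univ, Measure.restrict_univ,
      ← ofReal_integral_eq_lintegral_ofReal hpi (Eventually.of_forall fun x => (hp_pos x).le),
      hp_int, ENNReal.ofReal_one]
  have hQ : Q = c • P := by
    have h1 : μ.withDensity (fun x => ENNReal.ofReal (p x)) = Q := by
      have h2 := withDensity_inv_same (μ := Q) (f := fun x => (q x : ℝ≥0∞))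
        hqc.measurable.coe_nnreal_ennreal
        (Eventually.of_forall fun x => by simpa [q] using hp_pos x)
        (Eventually.of_forall fun x => by simp)
      rw [← h2]
      congr 1
      ext x
      change ENNReal.ofReal (p x) = (ENNReal.ofReal (p x)⁻¹)⁻¹
      rw [ENNReal.ofReal_inv_of_pos (hp_pos x), inv_inv]
    rw [← h1, hμ, hP]
    exact withDensity_smul_measure _ _
  have hc : (c : ℝ≥0∞) = 1 := by
    have h1 : Q Set.univ = 1 := measure_univ
    rw [hQ, Measure.smul_apply, hPprob] at h1
    simpa [ENNReal.smul_def] using h1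
  have hc' : c = 1 := by exact_mod_cast hc
  rw [hQ, hc', one_smul]
end

section
/- Let X be a Polish space that is locally compact and not compact, let k : X × X → ℝ be a bounded continuous kernel (symmetric and positive semidefinite), and let P be a Borel probability measure on X. Define the P-centered kernel k^P(x,y) := k(x,y) − ∫ k(x,z) dP(z) − ∫ k(y,z) dP(z) + ∬ k(z,w) dP(z) dP(w). Suppose that for every x ∈ X the function y ↦ k^P(x,y) vanishes at infinity. Then there exists a sequence (Q_n) of Borel probability measures on X such that ∬ k(x,y) d(Q_n − P)(x) d(Q_n − P)(y) → 0 while (Q_n) does not converge weakly to P, i.e., there exists a bounded continuous f : X → ℝ with ∫ f dQ_n not converging to ∫ f dP. -/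
open MeasureTheory Filter Topology

lemma integral_empirical_aux {X : Type*} [MeasurableSpace X] [MeasurableSingletonClass X]
    (N : ℕ) (y : ℕ → X) (g : X → ℝ) :
    ∫ x, g x ∂(((N : ENNReal)⁻¹) • ∑ i ∈ Finset.range N, Measure.dirac (y i))
      = (N : ℝ)⁻¹ * ∑ i ∈ Finset.range N, g (y i) := by
  rw [integral_smul_measure, integral_finset_sum_measure]
  · simp
  · intro i _
    exact integrable_dirac (by simp)

/-- **Decaying P-centered kernels fail to control P-convergence.** On a locally
compact, non-compact Polish space, if every section of the `P`-centered kernel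
`k^P` vanishes at infinity, then there is a sequence of probability measures whose
squared MMD to `P` tends to `0` but which does not converge weakly to `P`. -/
theorem decaying_centered_kernel_fails_convergence_control
    {X : Type*} [MetricSpace X]
    [TopologicalSpace.SeparableSpace X] [CompleteSpace X]
    [LocallyCompactSpace X] (hnc : ¬ CompactSpace X)
    [MeasurableSpace X] [BorelSpace X]
    (k : X → X → ℝ)
    (hk_cont : Continuous fun p : X × X => k p.1 p.2)
    (hk_symm : ∀ x y, k x y = k y x)
    (hk_psd : ∀ (n : ℕ) (x : Fin n → X) (c : Fin n → ℝ),
      0 ≤ ∑ i, ∑ j, c i * c j * k (x i) (x j))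
    (hk_bdd : ∃ M : ℝ, ∀ x y, |k x y| ≤ M)
    (P : Measure X) [IsProbabilityMeasure P]
    (kP : X → X → ℝ)
    (hkP : ∀ x y, kP x y = k x y - (∫ z, k x z ∂P) - (∫ z, k y z ∂P)
      + ∫ z, ∫ w, k z w ∂P ∂P)
    (hvanish : ∀ x, ∀ ε : ℝ, 0 < ε → ∃ C : Set X, IsCompact C ∧
      ∀ y ∉ C, |kP x y| ≤ ε) :
    ∃ Q : ℕ → Measure X, (∀ n, IsProbabilityMeasure (Q n)) ∧
      (Tendsto (fun n => (∫ x, ∫ y, k x y ∂(Q n) ∂(Q n))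
        - 2 * (∫ x, ∫ y, k x y ∂P ∂(Q n))
        + (∫ x, ∫ y, k x y ∂P ∂P)) atTop (𝓝 0)) ∧
      ∃ f : X → ℝ, Continuous f ∧ (∃ M : ℝ, ∀ x, |f x| ≤ M) ∧
        ¬ Tendsto (fun n => ∫ x, f x ∂(Q n)) atTop (𝓝 (∫ x, f x ∂P)) := by
  classical
  obtain ⟨M, hM⟩ := hk_bdd
  obtain ⟨K, hK, hPK⟩ : ∃ K : Set X, IsCompact K ∧ P K ≠ 0 := by
    by_contra! h
    have h1 : P (⋃ n, compactCovering X n) = 0 :=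
      measure_iUnion_null fun n => h _ (isCompact_compactCovering X n)
    rw [iUnion_compactCovering] at h1
    simp at h1
  obtain ⟨f, hf1, -, hfc, hf01⟩ := exists_continuous_one_zero_of_isCompact hK
    isClosed_empty (Set.disjoint_empty K)
  have hkPb : ∀ x y, |kP x y| ≤ 4 * M := by
    have hg : ∀ x, |∫ z, k x z ∂P| ≤ M := by
      intro x
      have := norm_integral_le_of_norm_le_const (μ := P) (f := fun z => k x z) (C := M)
        (Eventually.of_forall fun z => hM x z)
      simpa using this
    have hc : |∫ z, ∫ w, k z w ∂P ∂P| ≤ M := by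
      have := norm_integral_le_of_norm_le_const (μ := P) (f := fun z => ∫ w, k z w ∂P) (C := M)
        (Eventually.of_forall fun z => hg z)
      simpa using this
    intro x y
    rw [hkP]
    have h1 := abs_le.1 (hM x y)
    have h2 := abs_le.1 (hg x)
    have h3 := abs_le.1 (hg y)
    have h4 := abs_le.1 hc
    rw [abs_le]
    constructor <;> linarith
  have hsymm : ∀ x y, kP x y = kP y x := by
    intro x y
    rw [hkP, hkP, hk_symm x y]
    ring
  have hseq : ∀ ε : ℝ, 0 < ε → ∃ y : ℕ → X, (∀ n, y n ∉ tsupport f) ∧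
      ∀ m n, m < n → |kP (y m) (y n)| ≤ ε := by
    intro ε hε
    choose C hC hCε using fun x => hvanish x ε hε
    apply exists_seq_of_forall_finset_exists (fun y => y ∉ tsupport f)
      (fun x y => |kP x y| ≤ ε)
    intro s _
    have hcomp : IsCompact (tsupport f ∪ ⋃ x ∈ s, C x) :=
      hfc.isCompact.union (s.isCompact_biUnion fun x _ => hC x)
    obtain ⟨y, hy⟩ : ∃ y, y ∉ tsupport f ∪ ⋃ x ∈ s, C x := by
      by_contra! h
      exact hnc ⟨by rwa [Set.eq_univ_of_forall h] at hcomp⟩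
    simp only [Set.mem_union, Set.mem_iUnion, not_or, not_exists] at hy
    exact ⟨y, hy.1, fun x hx => hCε x y (hy.2 x hx)⟩
  choose y hyf hyk using fun n : ℕ => hseq ((n + 1 : ℝ)⁻¹) (by positivity)
  refine ⟨fun n => (((n + 1 : ℕ) : ENNReal)⁻¹) •
    ∑ i ∈ Finset.range (n + 1), Measure.dirac (y n i), ?_, ?_, f, f.continuous, ?_, ?_⟩
  · intro n
    constructor
    simp only [Measure.smul_apply, Measure.finset_sum_apply, measure_univ, Finset.sum_const,
      Finset.card_range, smul_eq_mul, nsmul_eq_mul, mul_one]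
    exact ENNReal.inv_mul_cancel (by simp) (ENNReal.natCast_ne_top _)
  · simp only [integral_empirical_aux]
    apply squeeze_zero_norm (a := fun n : ℕ => (4 * M + 1) * (1 / ((n : ℝ) + 1)))
    · intro n
      set N : ℝ := ((n + 1 : ℕ) : ℝ) with hN
      have hNpos : 0 < N := by positivity
      have hN1 : (n : ℝ) + 1 = N := by simp [hN]
      have key : N⁻¹ * ∑ i ∈ Finset.range (n + 1), (N⁻¹ * ∑ j ∈ Finset.range (n + 1),
            k (y n i) (y n j))
          - 2 * (N⁻¹ * ∑ i ∈ Finset.range (n + 1), ∫ z, k (y n i) z ∂P)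
          + ∫ z, ∫ w, k z w ∂P ∂P
          = N⁻¹ * (N⁻¹ * ∑ i ∈ Finset.range (n + 1), ∑ j ∈ Finset.range (n + 1),
            kP (y n i) (y n j)) := by
        simp only [hkP, Finset.sum_add_distrib, Finset.sum_sub_distrib, Finset.sum_const,
          Finset.card_range, nsmul_eq_mul, ← Finset.mul_sum]
        rw [← hN]
        field_simp
        ring
      rw [key, hN1]
      have hb : |∑ i ∈ Finset.range (n + 1), ∑ j ∈ Finset.range (n + 1),
          kP (y n i) (y n j)| ≤ N * (4 * M + 1) := by
        calc _ ≤ ∑ i ∈ Finset.range (n + 1), ∑ j ∈ Finset.range (n + 1),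
              ((if i = j then 4 * M else 0) + N⁻¹) := by
              refine (Finset.abs_sum_le_sum_abs _ _).trans (Finset.sum_le_sum fun i _ => ?_)
              refine (Finset.abs_sum_le_sum_abs _ _).trans (Finset.sum_le_sum fun j _ => ?_)
              have hinv : 0 < N⁻¹ := by positivity
              rcases lt_trichotomy i j with h | h | h
              · have := hyk n i j h
                rw [hN1] at this
                simpa [h.ne] using this
              · have := hkPb (y n i) (y n j)
                simp only [h, if_true] at this ⊢
                linarith
              · have := hyk n j i h
                rw [hN1, hsymm] at this
                simpa [h.ne'] using this
          _ = N * (4 * M + 1) := by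
              have : ∀ i ∈ Finset.range (n + 1), ∑ j ∈ Finset.range (n + 1),
                  ((if i = j then 4 * M else 0) + N⁻¹) = 4 * M + 1 := by
                intro i hi
                rw [Finset.sum_add_distrib, Finset.sum_ite_eq, if_pos hi, Finset.sum_const,
                  Finset.card_range, nsmul_eq_mul, ← hN, mul_inv_cancel₀ hNpos.ne']
              rw [Finset.sum_congr rfl this, Finset.sum_const, Finset.card_range, nsmul_eq_mul]
      rw [Real.norm_eq_abs, abs_mul, abs_mul, abs_of_pos (inv_pos.2 hNpos)]
      calc _ ≤ N⁻¹ * (N⁻¹ * (N * (4 * M + 1))) := by gcongr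
        _ = _ := by field_simp
    · simpa using (tendsto_one_div_add_atTop_nhds_zero_nat (𝕜 := ℝ)).const_mul (4 * M + 1)
  · exact ⟨1, fun x => abs_le.2 ⟨by linarith [(hf01 x).1], (hf01 x).2⟩⟩
  · intro h
    simp only [integral_empirical_aux] at h
    have hz : ∀ n i, f (y n i) = 0 := fun n i => image_eq_zero_of_notMem_tsupport (hyf n i)
    simp only [hz, Finset.sum_const_zero, mul_zero] at h
    have h0 : ∫ x, f x ∂P = 0 := tendsto_nhds_unique h tendsto_const_nhds
    rw [integral_eq_zero_iff_of_nonneg (fun x => (hf01 x).1)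
      (f.continuous.integrable_of_hasCompactSupport hfc)] at h0
    apply hPK
    refine measure_mono_null (fun x hx => ?_) (ae_iff.1 h0)
    have := hf1 hx
    simp at this
    simp [this]
end
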